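/- There exists an absolute constant c > 0 such that every combinatorial market admits a competitive bundling equilibrium whose welfare is at least c · OPT / (√μ · (log(μ) + 2)), where μ = min{n, m}. -/

import Mathlib

open Finset

/-- A combinatorial market with `n` consumers and `m` items. Each consumer has a
normalized (`v i ∅ = 0`) and monotone valuation over subsets of items. -/
structure Market (n m : ℕ) where
  v : Fin n → Finset (Fin m) → ℝ
  v_empty : ∀ i, v i ∅ = 0
  v_mono : ∀ i, ∀ S T : Finset (Fin m), S ⊆ T → v i S ≤ v i T

/-- An allocation assigns pairwise disjoint sets of items to consumers. -/
def IsAllocation {n m : ℕ} (S : Fin n → Finset (Fin m)) : Prop :=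
  ∀ i j : Fin n, i ≠ j → Disjoint (S i) (S j)

/-- The welfare of an allocation. -/
def allocWelfare {n m : ℕ} (Mk : Market n m) (S : Fin n → Finset (Fin m)) : ℝ :=
  ∑ i, Mk.v i (S i)

/-- The optimal welfare over all allocations. -/
noncomputable def OPT {n m : ℕ} (Mk : Market n m) : ℝ :=
  sSup {w : ℝ | ∃ S : Fin n → Finset (Fin m), IsAllocation S ∧ allocWelfare Mk S = w}

/-- A competitive bundling equilibrium: a partition of the items into nonempty bundles,
nonnegative bundle prices, and an assignment of every bundle to a consumer (market
clearance), such that every consumer's assigned set of bundles maximizes his profit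
over all sets of bundles. -/
structure CBE {n m : ℕ} (Mk : Market n m) where
  bundles : Finset (Finset (Fin m))
  price : Finset (Fin m) → ℝ
  assign : Finset (Fin m) → Fin n
  bundles_nonempty : ∀ b ∈ bundles, b.Nonempty
  bundles_disjoint : ∀ b ∈ bundles, ∀ b' ∈ bundles, b ≠ b' → Disjoint b b'
  bundles_cover : bundles.biUnion id = Finset.univ
  price_nonneg : ∀ b ∈ bundles, 0 ≤ price b
  profit_max : ∀ i : Fin n, ∀ T : Finset (Finset (Fin m)), T ⊆ bundles →
    Mk.v i ((bundles.filter fun b => assign b = i).biUnion id)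
        - ∑ b ∈ bundles.filter fun b => assign b = i, price b
      ≥ Mk.v i (T.biUnion id) - ∑ b ∈ T, price b

/-- The welfare of a competitive bundling equilibrium. -/
def CBE.welfare {n m : ℕ} {Mk : Market n m} (E : CBE Mk) : ℝ :=
  ∑ i, Mk.v i ((E.bundles.filter fun b => E.assign b = i).biUnion id)

/-- The revenue of a competitive bundling equilibrium. -/
def CBE.revenue {n m : ℕ} {Mk : Market n m} (E : CBE Mk) : ℝ :=
  ∑ b ∈ E.bundles, E.price b

/-- A market is multi-unit if valuations depend only on the number of items. -/
def MultiUnit {n m : ℕ} (Mk : Market n m) : Prop :=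
  ∀ i, ∀ S T : Finset (Fin m), S.card = T.card → Mk.v i S = Mk.v i T

/-- A partition of the items into nonempty bundles. -/
def IsBundling {m : ℕ} (B : Finset (Finset (Fin m))) : Prop :=
  (∀ b ∈ B, b.Nonempty) ∧ (∀ b ∈ B, ∀ b' ∈ B, b ≠ b' → Disjoint b b') ∧
    B.biUnion id = Finset.univ

/-- Approximate equilibria with bounded prices and a lower bound on the revenue. -/
def ApproxEq {n m : ℕ} (Mk : Market n m) (V R : ℝ) (B : Finset (Finset (Fin m)))
    (a : Finset (Fin m) → Fin n) (ε : ℝ) (p : Finset (Fin m) → ℝ) : Prop :=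
  (∀ b, 0 ≤ p b ∧ p b ≤ V) ∧ R ≤ ∑ b ∈ B, p b ∧
    ∀ i, ∀ T : Finset (Finset (Fin m)), T ⊆ B →
      Mk.v i (T.biUnion id) - ∑ b ∈ T, p b ≤
        Mk.v i ((B.filter fun b => a b = i).biUnion id)
          - ∑ b ∈ B.filter (fun b => a b = i), p b + ε

lemma ApproxEq.mono {n m : ℕ} {Mk : Market n m} {V R : ℝ} {B : Finset (Finset (Fin m))}
    {a : Finset (Fin m) → Fin n} {ε ε' : ℝ} {p : Finset (Fin m) → ℝ} (hε : ε ≤ ε')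
    (h : ApproxEq Mk V R B a ε p) : ApproxEq Mk V R B a ε' p :=
  ⟨h.1, h.2.1, fun i T hT => (h.2.2 i T hT).trans (by linarith)⟩

lemma isClosed_approxEq {n m : ℕ} (Mk : Market n m) (V R : ℝ) (B : Finset (Finset (Fin m)))
    (a : Finset (Fin m) → Fin n) (ε : ℝ) : IsClosed {p | ApproxEq Mk V R B a ε p} := by
  unfold ApproxEq
  simp only [Set.ofPred_and, Set.ofPred_forall]
  refine IsClosed.inter ?_ (IsClosed.inter ?_ ?_)
  · refine isClosed_iInter fun b => IsClosed.inter ?_ ?_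
    · exact isClosed_le continuous_const (continuous_apply b)
    · exact isClosed_le (continuous_apply b) continuous_const
  · exact isClosed_le continuous_const (by fun_prop)
  · refine isClosed_iInter fun i => isClosed_iInter fun T => isClosed_iInter fun _ => ?_
    exact isClosed_le (by fun_prop) (by fun_prop)

lemma approx_limit {n m : ℕ} (Mk : Market n m) (V R ε₀ : ℝ) (hε₀ : 0 < ε₀)
    (h : ∀ ε, 0 < ε → ε < ε₀ → ∃ B a p, IsBundling B ∧ ApproxEq Mk V R B a ε p) :
    ∃ B a p, IsBundling B ∧ ApproxEq Mk V R B a 0 p := by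
  let e : ℕ → ℝ := fun N => ε₀ / ((N : ℝ) + 2)
  have he : ∀ N, 0 < e N := fun N => by positivity
  have he' : ∀ N, e N < ε₀ := fun N => by
    apply div_lt_self hε₀
    have : (0 : ℝ) ≤ N := Nat.cast_nonneg N
    linarith
  have hanti : ∀ N N', N ≤ N' → e N' ≤ e N := fun N N' hN => by
    have : (N : ℝ) ≤ N' := by exact_mod_cast hN
    apply div_le_div_of_nonneg_left hε₀.le (by positivity) (by linarith)
  have h' : ∀ N, ∃ x : Finset (Finset (Fin m)) × (Finset (Fin m) → Fin n),
      ∃ p, IsBundling x.1 ∧ ApproxEq Mk V R x.1 x.2 (e N) p := fun N => by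
    obtain ⟨B, a, p, h1, h2⟩ := h (e N) (he N) (he' N)
    exact ⟨(B, a), p, h1, h2⟩
  choose x p hB hp using h'
  obtain ⟨y, hy⟩ := Finite.exists_infinite_fiber x
  have hinf : (x ⁻¹' {y}).Infinite := Set.infinite_coe_iff.mp hy
  have hex : ∀ N, ∃ N', N ≤ N' ∧ x N' = y := fun N => by
    obtain ⟨N', h1, h2⟩ := hinf.exists_gt N
    exact ⟨N', h2.le, h1⟩
  let t : ℕ → Set (Finset (Fin m) → ℝ) := fun N => {p | ApproxEq Mk V R y.1 y.2 (e N) p}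
  have hne : (⋂ N, t N).Nonempty := by
    apply IsCompact.nonempty_iInter_of_sequence_nonempty_isCompact_isClosed
    · intro N q hq
      exact ApproxEq.mono (hanti _ _ (Nat.le_succ N)) hq
    · intro N
      obtain ⟨N', h1, h2⟩ := hex N
      refine ⟨p N', ?_⟩
      have := hp N'
      rw [h2] at this
      exact this.mono (hanti _ _ h1)
    · refine IsCompact.of_isClosed_subset (isCompact_univ_pi (fun _ => isCompact_Icc (a := (0:ℝ)) (b := V)))
        (isClosed_approxEq _ _ _ _ _ _) ?_
      intro q hq b _
      exact hq.1 b
    · intro N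
      exact isClosed_approxEq _ _ _ _ _ _
  obtain ⟨q, hq⟩ := hne
  rw [Set.mem_iInter] at hq
  obtain ⟨N0, -, hN0⟩ := hex 0
  refine ⟨y.1, y.2, q, hN0 ▸ hB N0, (hq 0).1, (hq 0).2.1, fun i T hT => ?_⟩
  have hlim : Filter.Tendsto e Filter.atTop (nhds 0) := by
    have h1 : Filter.Tendsto (fun N : ℕ => (N : ℝ) + 2) Filter.atTop Filter.atTop :=
      Filter.tendsto_atTop_add_const_right _ _ tendsto_natCast_atTop_atTop
    exact Filter.Tendsto.const_div_atTop h1 ε₀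
  exact ge_of_tendsto' (hlim.const_add _) (fun N => (hq N).2.2 i T hT)

/-- States of the ascending bundling auction. -/
structure AState {n m : ℕ} (Mk : Market n m) (G : Finset (Finset (Fin m))) (r ε : ℝ)
    (B : Finset (Finset (Fin m))) (p : Finset (Fin m) → ℝ)
    (a : Finset (Fin m) → Option (Fin n)) : Prop where
  bund : IsBundling B
  card : B.card ≤ G.card
  nonneg : ∀ b ∈ B, 0 ≤ p b
  rev : G.card * r ≤ ∑ b ∈ B, p b
  unsold : ∀ b ∈ B, a b = none → b ∈ G ∧ p b = r
  inj : ∀ b ∈ B, ∀ b' ∈ B, ∀ i, a b = some i → a b' = some i → b = b'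
  regret : ∀ b ∈ B, ∀ i, a b = some i → ∀ T ⊆ B,
    Mk.v i (T.biUnion id) - ∑ c ∈ T, p c ≤ Mk.v i b - p b + ε

lemma Market.nonneg {n m : ℕ} (Mk : Market n m) (i : Fin n) (S : Finset (Fin m)) :
    0 ≤ Mk.v i S := by
  rw [← Mk.v_empty i]; exact Mk.v_mono i _ _ (Finset.empty_subset _)

lemma AState.price_le {n m : ℕ} {Mk : Market n m} {G B : Finset (Finset (Fin m))} {r ε : ℝ}
    {p : Finset (Fin m) → ℝ} {a : Finset (Fin m) → Option (Fin n)} (hr : 0 ≤ r) (hε : 0 ≤ ε)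
    (s : AState Mk G r ε B p a) : ∀ b ∈ B, p b ≤ r + ε + ∑ i, Mk.v i Finset.univ := by
  intro b hb
  have hs : 0 ≤ ∑ i, Mk.v i Finset.univ := Finset.sum_nonneg fun i _ => Mk.nonneg i _
  cases h : a b with
  | none => rw [(s.unsold b hb h).2]; linarith
  | some i =>
    have h1 := s.regret b hb i h ∅ (Finset.empty_subset _)
    simp only [Finset.biUnion_empty, Mk.v_empty, Finset.sum_empty] at h1
    have h2 := Mk.v_mono i b Finset.univ (Finset.subset_univ _)
    have h3 : Mk.v i Finset.univ ≤ ∑ i, Mk.v i Finset.univ :=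
      Finset.single_le_sum (f := fun i => Mk.v i Finset.univ)
        (fun i _ => Mk.nonneg i _) (Finset.mem_univ i)
    linarith

lemma AState.step {n m : ℕ} {Mk : Market n m} {G B : Finset (Finset (Fin m))} {r ε : ℝ}
    {p : Finset (Fin m) → ℝ} {a : Finset (Fin m) → Option (Fin n)} (hε : 0 < ε)
    (s : AState Mk G r ε B p a) (i : Fin n) (hi : ∀ b ∈ B, a b ≠ some i)
    (T₀ : Finset (Finset (Fin m))) (hT₀ : T₀ ⊆ B)
    (hgain : ε < Mk.v i (T₀.biUnion id) - ∑ c ∈ T₀, p c) :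
    ∃ B' p' a', AState Mk G r ε B' p' a' ∧ ∑ b ∈ B', p' b = ∑ b ∈ B, p b + ε := by
  obtain ⟨T, hTm, hTmax⟩ := Finset.exists_max_image B.powerset
    (fun T => Mk.v i (T.biUnion id) - ∑ c ∈ T, p c) ⟨T₀, Finset.mem_powerset.mpr hT₀⟩
  have hT : T ⊆ B := Finset.mem_powerset.mp hTm
  have hTg : ε < Mk.v i (T.biUnion id) - ∑ c ∈ T, p c :=
    hgain.trans_le (hTmax T₀ (Finset.mem_powerset.mpr hT₀))
  have hTne : T.Nonempty := by
    rw [Finset.nonempty_iff_ne_empty]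
    rintro rfl
    simp only [Finset.biUnion_empty, Mk.v_empty, Finset.sum_empty] at hTg
    linarith
  obtain ⟨b1, b2, b3⟩ := s.bund
  set U : Finset (Fin m) := T.biUnion id with hU
  have hUne : U.Nonempty := by
    obtain ⟨b, hb⟩ := hTne
    obtain ⟨x, hx⟩ := b1 b (hT hb)
    exact ⟨x, Finset.mem_biUnion.mpr ⟨b, hb, hx⟩⟩
  have hUd : ∀ b ∈ B \ T, Disjoint U b := by
    intro b hb
    rw [hU, Finset.disjoint_biUnion_left]
    intro c hc
    rw [Finset.mem_sdiff] at hb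
    exact b2 c (hT hc) b hb.1 (by rintro rfl; exact hb.2 hc)
  have hUn : U ∉ B \ T := fun h => by
    have := hUd U h
    rw [disjoint_self] at this
    exact hUne.ne_empty this
  have hneU : ∀ b ∈ B \ T, b ≠ U := fun b hb h => hUn (h ▸ hb)
  set p' := Function.update p U (∑ c ∈ T, p c + ε) with hp'
  set a' := Function.update a U (some i) with ha'
  have hp'U : p' U = ∑ c ∈ T, p c + ε := by simp [hp']
  have hp'b : ∀ b ∈ B \ T, p' b = p b := fun b hb => by
    simp [hp', Function.update_of_ne (hneU b hb)]
  have ha'U : a' U = some i := by simp [ha']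
  have ha'b : ∀ b ∈ B \ T, a' b = a b := fun b hb => by
    simp [ha', Function.update_of_ne (hneU b hb)]
  have hsum : ∑ b ∈ insert U (B \ T), p' b = ∑ b ∈ B, p b + ε := by
    rw [Finset.sum_insert hUn, hp'U, Finset.sum_congr rfl hp'b, ← Finset.sum_sdiff hT]
    ring
  have hpull : ∀ T' ⊆ insert U (B \ T), ∃ T'' ⊆ B, T''.biUnion id = T'.biUnion id ∧
      ∑ c ∈ T'', p c ≤ ∑ c ∈ T', p' c := by
    intro T' hT'
    by_cases hUT : U ∈ T'
    · have hR : T'.erase U ⊆ B \ T := by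
        intro b hb
        rw [Finset.mem_erase] at hb
        exact (Finset.mem_insert.mp (hT' hb.2)).resolve_left hb.1
      refine ⟨T ∪ T'.erase U, Finset.union_subset hT (hR.trans Finset.sdiff_subset), ?_, ?_⟩
      · conv_rhs => rw [← Finset.insert_erase hUT]
        rw [Finset.union_biUnion, Finset.biUnion_insert]
        rfl
      · rw [Finset.sum_union (Finset.disjoint_sdiff.mono_right hR),
          ← Finset.add_sum_erase _ _ hUT, hp'U,
          Finset.sum_congr rfl (fun b hb => hp'b b (hR hb))]
        linarith
    · have hR : T' ⊆ B \ T := by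
        intro b hb
        exact (Finset.mem_insert.mp (hT' hb)).resolve_left (by rintro rfl; exact hUT hb)
      refine ⟨T', hR.trans Finset.sdiff_subset, rfl, ?_⟩
      rw [Finset.sum_congr rfl (fun b hb => hp'b b (hR hb))]
  refine ⟨insert U (B \ T), p', a', ⟨⟨?_, ?_, ?_⟩, ?_, ?_, ?_, ?_, ?_, ?_⟩, hsum⟩
  · intro b hb
    rcases Finset.mem_insert.mp hb with rfl | hb
    · exact hUne
    · exact b1 b (Finset.mem_sdiff.mp hb).1
  · intro b hb c hc hbc
    rcases Finset.mem_insert.mp hb with hb | hb <;> rcases Finset.mem_insert.mp hc with hc | hc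
    · exact absurd (hb.trans hc.symm) hbc
    · rw [hb]; exact hUd c hc
    · rw [hc]; exact (hUd b hb).symm
    · exact b2 b (Finset.mem_sdiff.mp hb).1 c (Finset.mem_sdiff.mp hc).1 hbc
  · rw [Finset.biUnion_insert, ← b3]
    conv_rhs => rw [← Finset.union_sdiff_of_subset hT, Finset.union_biUnion]
    rfl
  · rw [Finset.card_insert_of_notMem hUn, Finset.card_sdiff_of_subset hT]
    have h1 := hTne.card_pos
    have h2 := Finset.card_le_card hT
    have h3 := s.card
    omega
  · intro b hb
    rcases Finset.mem_insert.mp hb with rfl | hb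
    · rw [hp'U]
      have := Finset.sum_nonneg (fun c hc => s.nonneg c (hT hc))
      linarith
    · rw [hp'b b hb]; exact s.nonneg b (Finset.mem_sdiff.mp hb).1
  · rw [hsum]; linarith [s.rev]
  · intro b hb hn
    rcases Finset.mem_insert.mp hb with rfl | hb
    · rw [ha'U] at hn; cases hn
    · rw [ha'b b hb] at hn
      rw [hp'b b hb]
      exact s.unsold b (Finset.mem_sdiff.mp hb).1 hn
  · intro b hb c hc j hbj hcj
    rcases Finset.mem_insert.mp hb with hb | hb <;> rcases Finset.mem_insert.mp hc with hc | hc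
    · exact hb.trans hc.symm
    · rw [hb, ha'U] at hbj
      rw [ha'b c hc, ← hbj] at hcj
      exact absurd hcj (hi c (Finset.mem_sdiff.mp hc).1)
    · rw [hc, ha'U] at hcj
      rw [ha'b b hb, ← hcj] at hbj
      exact absurd hbj (hi b (Finset.mem_sdiff.mp hb).1)
    · rw [ha'b b hb] at hbj
      rw [ha'b c hc] at hcj
      exact s.inj b (Finset.mem_sdiff.mp hb).1 c (Finset.mem_sdiff.mp hc).1 j hbj hcj
  · intro b hb j hbj T' hT'
    obtain ⟨T'', h1, h2, h3⟩ := hpull T' hT'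
    rw [← h2]
    rcases Finset.mem_insert.mp hb with hb | hb
    · rw [hb, ha'U] at hbj
      obtain rfl : i = j := Option.some.inj hbj
      rw [hb, hp'U]
      have := hTmax T'' (Finset.mem_powerset.mpr h1)
      linarith
    · rw [ha'b b hb] at hbj
      rw [hp'b b hb]
      have := s.regret b (Finset.mem_sdiff.mp hb).1 j hbj T'' h1
      linarith

lemma auction {n m : ℕ} (Mk : Market n m) (G : Finset (Finset (Fin m))) (hG : IsBundling G)
    (r η : ℝ) (hr : 0 ≤ r) (hn : 1 ≤ n)
    (hD : ∀ b ∈ G, ∃ D : Finset (Fin n), G.card ≤ D.card ∧ ∀ i ∈ D, r + η ≤ Mk.v i b)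
    (ε : ℝ) (hε : 0 < ε) (hεη : ε < η) :
    ∃ B a p, IsBundling B ∧
      ApproxEq Mk (r + η + ∑ i, Mk.v i Finset.univ) (G.card * r) B a ε p := by
  let Rv : Set ℝ := {w | ∃ B p a, AState Mk G r ε B p a ∧ ∑ b ∈ B, p b = w}
  have hne : Rv.Nonempty := by
    refine ⟨_, G, fun _ => r, fun _ => none, ⟨hG, le_rfl, fun _ _ => hr, ?_, ?_, ?_, ?_⟩, rfl⟩
    · simp
    · intro b hb _; exact ⟨hb, rfl⟩
    · intro _ _ _ _ _ h; cases h
    · intro _ _ _ h; cases h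
  have hbdd : BddAbove Rv := by
    refine ⟨G.card * (r + ε + ∑ i, Mk.v i Finset.univ), ?_⟩
    rintro w ⟨B, p, a, s, rfl⟩
    have hs : 0 ≤ ∑ i, Mk.v i Finset.univ := Finset.sum_nonneg fun i _ => Mk.nonneg i _
    calc ∑ b ∈ B, p b ≤ B.card • (r + ε + ∑ i, Mk.v i Finset.univ) :=
          Finset.sum_le_card_nsmul _ _ _ (s.price_le hr hε.le)
      _ ≤ _ := by
        rw [nsmul_eq_mul]
        apply mul_le_mul_of_nonneg_right
        · exact_mod_cast s.card
        · linarith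
  obtain ⟨w, ⟨B, p, a, s, rfl⟩, hw⟩ := exists_lt_of_lt_csSup hne (sub_lt_self (sSup Rv) hε)
  -- no free consumer gains more than `ε`
  have hfree : ∀ i, (∀ b ∈ B, a b ≠ some i) → ∀ T ⊆ B,
      Mk.v i (T.biUnion id) - ∑ c ∈ T, p c ≤ ε := by
    intro i hi T hT
    by_contra hcon
    push Not at hcon
    obtain ⟨B', p', a', s', h'⟩ := s.step hε i hi T hT hcon
    have := le_csSup hbdd (show _ ∈ Rv from ⟨B', p', a', s', h'⟩)
    linarith
  have hsold : ∀ b ∈ B, a b ≠ none := by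
    intro b hb hbn
    obtain ⟨hbG, hbp⟩ := s.unsold b hb hbn
    obtain ⟨D, hDc, hDv⟩ := hD b hbG
    have hhold : ∀ i ∈ D, ∃ c ∈ B, a c = some i := by
      intro i hi
      by_contra hcon
      push Not at hcon
      have h1 := hfree i hcon {b} (by simpa using hb)
      have h2 := hDv i hi
      simp only [Finset.singleton_biUnion, id, Finset.sum_singleton, hbp] at h1
      linarith
    choose! f hfB hfa using hhold
    have h1 : D.card ≤ (B.erase b).card := by
      apply Finset.card_le_card_of_injOn f
      · intro i hi
        rw [Finset.mem_coe, Finset.mem_erase]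
        refine ⟨?_, hfB i hi⟩
        intro h
        have := hfa i hi
        rw [h, hbn] at this
        cases this
      · intro i hi j hj hij
        have h1 := hfa i hi
        have h2 := hfa j hj
        rw [hij, h2] at h1
        exact (Option.some.inj h1).symm
    rw [Finset.card_erase_of_mem hb] at h1
    have h2 := s.card
    have h3 : 0 < B.card := Finset.card_pos.mpr ⟨b, hb⟩
    omega
  let d : Fin n := ⟨0, hn⟩
  let p' : Finset (Fin m) → ℝ := fun b => if b ∈ B then p b else 0
  have hp' : ∀ T ⊆ B, ∑ b ∈ T, p' b = ∑ b ∈ T, p b := fun T hT =>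
    Finset.sum_congr rfl fun b hb => by simp [p', hT hb]
  have hs : 0 ≤ ∑ i, Mk.v i Finset.univ := Finset.sum_nonneg fun i _ => Mk.nonneg i _
  have hadj : ∀ b ∈ B, ∀ i, (a b).getD d = i ↔ a b = some i := by
    intro b hb i
    cases h : a b with
    | none => exact absurd h (hsold b hb)
    | some j => simp
  refine ⟨B, fun b => (a b).getD d, p', s.bund, ?_, ?_, ?_⟩
  · intro b
    by_cases hb : b ∈ B
    · simp only [p', hb, if_true]
      exact ⟨s.nonneg b hb, (s.price_le hr hε.le b hb).trans (by linarith)⟩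
    · simp only [p', hb, if_false]
      exact ⟨le_rfl, by linarith⟩
  · rw [hp' B subset_rfl]; exact s.rev
  · intro i T hT
    rw [hp' T hT, hp' _ (Finset.filter_subset _ _)]
    by_cases hi : ∃ b ∈ B, a b = some i
    · obtain ⟨b, hb, hbi⟩ := hi
      have : (B.filter fun b => (a b).getD d = i) = {b} := by
        ext c
        rw [Finset.mem_filter, Finset.mem_singleton]
        constructor
        · rintro ⟨hc, hci⟩
          exact s.inj c hc b hb i ((hadj c hc i).mp hci) hbi
        · rintro rfl
          exact ⟨hb, (hadj c hb i).mpr hbi⟩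
      rw [this]
      simpa using s.regret b hb i hbi T hT
    · push Not at hi
      have : (B.filter fun b => (a b).getD d = i) = ∅ := by
        rw [Finset.filter_eq_empty_iff]
        intro c hc hci
        exact hi c hc ((hadj c hc i).mp hci)
      rw [this]
      simpa [Mk.v_empty] using hfree i hi T hT

lemma exists_cbe {n m : ℕ} (Mk : Market n m) (G : Finset (Finset (Fin m))) (hG : IsBundling G)
    (r η : ℝ) (hr : 0 ≤ r) (hη : 0 < η) (hn : 1 ≤ n)
    (hD : ∀ b ∈ G, ∃ D : Finset (Fin n), G.card ≤ D.card ∧ ∀ i ∈ D, r + η ≤ Mk.v i b) :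
    ∃ E : CBE Mk, G.card * r ≤ E.welfare := by
  obtain ⟨B, a, p, hB, h1, h2, h3⟩ := approx_limit Mk _ _ η hη
    (auction Mk G hG r η hr hn hD)
  refine ⟨⟨B, p, a, hB.1, hB.2.1, hB.2.2, fun b _ => (h1 b).1, fun i T hT => ?_⟩, ?_⟩
  · have := h3 i T hT
    linarith
  · refine h2.trans ?_
    unfold CBE.welfare
    rw [← Finset.sum_fiberwise B a p]
    refine Finset.sum_le_sum fun i _ => ?_
    have := h3 i ∅ (Finset.empty_subset _)
    simp only [Finset.biUnion_empty, Mk.v_empty, Finset.sum_empty] at this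
    simp only
    linarith

lemma exists_cbe_of_alloc {n m : ℕ} (Mk : Market n m) (hn : 1 ≤ n)
    (S : Fin n → Finset (Fin m)) (hS : IsAllocation S) (v : ℝ) (hv : 0 < v)
    (k : ℕ) (hk : 1 ≤ k) (J : Finset (Fin n)) (hJ : ∀ i ∈ J, v ≤ Mk.v i (S i))
    (hkJ : k * k ≤ J.card) : ∃ E : CBE Mk, k * (v / 2) ≤ E.welfare := by
  have : Nonempty (Fin k × Fin k ↪ J) := by
    apply Function.Embedding.nonempty_of_card_le
    simpa using hkJ
  obtain ⟨e⟩ := this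
  have : NeZero k := ⟨by omega⟩
  have hSne : ∀ i ∈ J, (S i).Nonempty := by
    intro i hi
    rw [Finset.nonempty_iff_ne_empty]
    intro h
    have := hJ i hi
    rw [h, Mk.v_empty] at this
    linarith
  have hg : ∀ x : Fin m, ∃ c : Fin k, ∀ c' d', x ∈ S (e (c', d')) → c = c' := by
    intro x
    by_cases h : ∃ y, x ∈ S (e y)
    · obtain ⟨y, hy⟩ := h
      refine ⟨y.1, fun c' d' h' => ?_⟩
      by_contra hne
      have hne' : (e y : Fin n) ≠ e (c', d') := by
        intro h
        have := e.injective (Subtype.ext h)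
        rw [this] at hne
        exact hne rfl
      exact Finset.disjoint_left.mp (hS _ _ hne') hy h'
    · push Not at h
      exact ⟨0, fun c' d' h' => absurd h' (h _)⟩
  choose g hg using hg
  let Gr : Fin k → Finset (Fin m) := fun c => Finset.univ.filter fun x => g x = c
  have hsub : ∀ c d, S (e (c, d)) ⊆ Gr c := by
    intro c d x hx
    simp only [Gr, Finset.mem_filter, Finset.mem_univ, true_and]
    exact hg x c d hx
  have hGne : ∀ c, (Gr c).Nonempty := fun c =>
    (hSne _ (e (c, 0)).2).mono (hsub c 0)
  have hGd : ∀ c c', c ≠ c' → Disjoint (Gr c) (Gr c') := by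
    intro c c' h
    rw [Finset.disjoint_left]
    intro x hx hx'
    simp only [Gr, Finset.mem_filter, Finset.mem_univ, true_and] at hx hx'
    exact h (hx.symm.trans hx')
  have hinj : Function.Injective Gr := by
    intro c c' h
    by_contra hne
    have := hGd c c' hne
    rw [h, disjoint_self] at this
    exact (hGne c').ne_empty this
  have hcard : (Finset.univ.image Gr).card = k := by
    rw [Finset.card_image_of_injective _ hinj, Finset.card_univ, Fintype.card_fin]
  have := exists_cbe Mk (Finset.univ.image Gr) ⟨?_, ?_, ?_⟩ (v / 2) (v / 2) (by linarith)
    (by linarith) hn ?_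
  · rwa [hcard] at this
  · intro b hb
    obtain ⟨c, -, rfl⟩ := Finset.mem_image.mp hb
    exact hGne c
  · intro b hb b' hb' hne
    obtain ⟨c, -, rfl⟩ := Finset.mem_image.mp hb
    obtain ⟨c', -, rfl⟩ := Finset.mem_image.mp hb'
    exact hGd c c' (by rintro rfl; exact hne rfl)
  · ext x
    simp [Gr]
  · intro b hb
    obtain ⟨c, -, rfl⟩ := Finset.mem_image.mp hb
    refine ⟨Finset.univ.image fun d => (e (c, d) : Fin n), ?_, ?_⟩
    · rw [hcard, Finset.card_image_of_injective, Finset.card_univ, Fintype.card_fin]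
      intro d d' h
      have := e.injective (Subtype.ext h)
      simpa using this
    · intro i hi
      obtain ⟨d, -, rfl⟩ := Finset.mem_image.mp hi
      have h1 := hJ _ (e (c, d)).2
      have h2 := Mk.v_mono (e (c, d)) _ _ (hsub c d)
      linarith

lemma sum_le_harmonic {ι : Type*} [DecidableEq ι] (f : ι → ℝ) (X : ℝ) (hX : 0 ≤ X) (N : ℕ) :
    ∀ I : Finset ι, I.card = N →
      (∀ i ∈ I, ((I.filter fun j => f i ≤ f j).card : ℝ) * f i ≤ X) →
      (∀ i ∈ I, 0 ≤ f i) →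
      ∑ i ∈ I, f i ≤ X * (harmonic N : ℝ) := by
  induction N with
  | zero =>
    intro I hI _ _
    rw [Finset.card_eq_zero] at hI
    subst hI
    simp
  | succ N ih =>
    intro I hI h h0
    have hne : I.Nonempty := by rw [← Finset.card_pos]; omega
    obtain ⟨i, hi, hmin⟩ := Finset.exists_min_image I f hne
    have h1 := ih (I.erase i) (by rw [Finset.card_erase_of_mem hi]; omega) (by
      intro j hj
      have hjI := Finset.mem_of_mem_erase hj
      refine le_trans ?_ (h j hjI)
      apply mul_le_mul_of_nonneg_right _ (h0 j hjI)
      exact_mod_cast Finset.card_le_card (Finset.filter_subset_filter _ (Finset.erase_subset _ _)))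
      (fun j hj => h0 j (Finset.mem_of_mem_erase hj))
    have h2 := h i hi
    rw [Finset.filter_true_of_mem hmin, hI] at h2
    rw [← Finset.add_sum_erase _ _ hi, harmonic_succ]
    push_cast at h2 ⊢
    have h3 : f i ≤ X * ((N : ℝ) + 1)⁻¹ := by
      rw [← div_eq_mul_inv, le_div_iff₀ (by positivity)]
      linarith
    rw [mul_add]
    linarith

/-- There is an absolute constant `c > 0` such that every market admits a
CBE with welfare at least `c * OPT / (√μ * (log₂ μ + 2))`, `μ = min n m`. -/
theorem general_sqrt_mu_approx :
    ∃ c : ℝ, 0 < c ∧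
      ∀ (n m : ℕ), 1 ≤ n → 1 ≤ m → ∀ (Mk : Market n m),
        ∃ E : CBE Mk,
          E.welfare ≥
            c * OPT Mk / (Real.sqrt (min n m : ℕ) * (Real.logb 2 (min n m : ℕ) + 2)) := by

  refine ⟨1 / 8, by norm_num, fun n m hn hm Mk => ?_⟩
  set μ : ℕ := min n m with hμ
  have hμ1 : 1 ≤ μ := le_min hn hm
  have hμR : (1 : ℝ) ≤ μ := by exact_mod_cast hμ1
  have hlog : 0 ≤ Real.logb 2 μ := Real.logb_nonneg (by norm_num) hμR
  have hsq : 0 < Real.sqrt μ := Real.sqrt_pos.mpr (by linarith)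
  have hmem : OPT Mk ∈ {w : ℝ | ∃ S : Fin n → Finset (Fin m), IsAllocation S ∧
      allocWelfare Mk S = w} := by
    apply Set.Nonempty.csSup_mem
    · exact ⟨_, fun _ => ∅, fun i j _ => by simp, rfl⟩
    · refine (Set.finite_range (allocWelfare Mk)).subset ?_
      rintro w ⟨S, -, rfl⟩
      exact ⟨S, rfl⟩
  obtain ⟨S, hS, hSO⟩ := hmem
  rcases le_or_gt (OPT Mk) 0 with hO | hO
  · -- degenerate case: all valuations vanish
    have hbdd : BddAbove {w : ℝ | ∃ S : Fin n → Finset (Fin m), IsAllocation S ∧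
        allocWelfare Mk S = w} := by
      refine ((Set.finite_range (allocWelfare Mk)).subset ?_).bddAbove
      rintro w ⟨S, -, rfl⟩
      exact ⟨S, rfl⟩
    have hz : ∀ i T, Mk.v i T = 0 := by
      intro i T
      apply le_antisymm _ (Mk.nonneg i T)
      refine le_trans ?_ hO
      refine le_trans ?_ (le_csSup hbdd ⟨fun j => if j = i then T else ∅, ?_, rfl⟩)
      · unfold allocWelfare
        refine le_trans ?_ (Finset.single_le_sum (fun j _ => Mk.nonneg j _) (Finset.mem_univ i))
        simp
      · intro j j' hjj
        by_cases h : j = i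
        · have : j' ≠ i := fun h' => hjj (h.trans h'.symm)
          simp [this]
        · simp [h]
    refine ⟨⟨{Finset.univ}, fun _ => 0, fun _ => ⟨0, hn⟩, ?_, ?_, ?_, ?_, ?_⟩, ?_⟩
    · intro b hb
      rw [Finset.mem_singleton.mp hb]
      exact ⟨⟨0, hm⟩, Finset.mem_univ _⟩
    · intro b hb b' hb' h
      exact absurd ((Finset.mem_singleton.mp hb).trans (Finset.mem_singleton.mp hb').symm) h
    · simp
    · simp
    · intro i T _
      simp [hz]
    · have h1 : 1 / 8 * OPT Mk / (Real.sqrt μ * (Real.logb 2 μ + 2)) ≤ 0 :=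
        div_nonpos_of_nonpos_of_nonneg (by linarith) (by positivity)
      refine le_trans h1 ?_
      unfold CBE.welfare
      exact Finset.sum_nonneg fun i _ => Mk.nonneg i _
  · by_contra hcon
    push Not at hcon
    set W := 1 / 8 * OPT Mk / (Real.sqrt μ * (Real.logb 2 μ + 2)) with hW
    have hWpos : 0 < W := by positivity
    let f : Fin n → ℝ := fun i => Mk.v i (S i)
    let I : Finset (Fin n) := Finset.univ.filter fun i => 0 < f i
    have hIf : ∀ i ∈ I, 0 < f i := fun i hi => (Finset.mem_filter.mp hi).2
    have hsumI : ∑ i ∈ I, f i = OPT Mk := by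
      rw [← hSO, allocWelfare]
      apply Finset.sum_subset (Finset.subset_univ _)
      intro i _ hi
      have : ¬ 0 < f i := fun h => hi (Finset.mem_filter.mpr ⟨Finset.mem_univ _, h⟩)
      exact le_antisymm (not_lt.mp this) (Mk.nonneg _ _)
    have hIμ : I.card ≤ μ := by
      apply le_min
      · simpa using Finset.card_le_univ I
      · have hne : ∀ i ∈ I, ∃ x, x ∈ S i := by
          intro i hi
          by_contra h
          have h' : S i = ∅ := Finset.not_nonempty_iff_eq_empty.mp h
          have := hIf i hi
          simp [f, h', Mk.v_empty] at this
        have : Nonempty (Fin m) := ⟨⟨0, hm⟩⟩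
        choose! x hx using hne
        have := Finset.card_le_card_of_injOn (s := I) (t := Finset.univ) x (by simp) (by
          intro i hi j hj hij
          by_contra h
          have h1 := hx i hi
          rw [hij] at h1
          exact Finset.disjoint_left.mp (hS i j h) h1 (hx j hj))
        simpa using this
    have key : ∀ i ∈ I, ((I.filter fun j => f i ≤ f j).card : ℝ) * f i ≤
        4 * Real.sqrt μ * W := by
      intro i hi
      set t := (I.filter fun j => f i ≤ f j).card with ht
      have ht1 : 1 ≤ t := Finset.card_pos.mpr ⟨i, Finset.mem_filter.mpr ⟨hi, le_rfl⟩⟩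
      have htμ : t ≤ μ := (Finset.card_le_card (Finset.filter_subset _ _)).trans hIμ
      have hk1 : 1 ≤ Nat.sqrt t := Nat.sqrt_pos.mpr ht1
      obtain ⟨E, hE⟩ := exists_cbe_of_alloc Mk hn S hS (f i) (hIf i hi) (Nat.sqrt t) hk1
        (I.filter fun j => f i ≤ f j) (fun j hj => (Finset.mem_filter.mp hj).2) (Nat.sqrt_le t)
      have hEW := hcon E
      have h1 : Real.sqrt t ≤ 2 * (Nat.sqrt t : ℝ) := by
        have h2 : Real.sqrt t ≤ (Nat.sqrt t : ℝ) + 1 := Real.real_sqrt_le_nat_sqrt_succ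
        have h3 : (1 : ℝ) ≤ Nat.sqrt t := by exact_mod_cast hk1
        linarith
      have h2 : Real.sqrt t ≤ Real.sqrt μ := Real.sqrt_le_sqrt (by exact_mod_cast htμ)
      have h3 : Real.sqrt t * Real.sqrt t = t := Real.mul_self_sqrt (Nat.cast_nonneg t)
      have hfi := hIf i hi
      have h4 : Real.sqrt t * f i ≤ 4 * W := by
        have := mul_le_mul_of_nonneg_right h1 hfi.le
        linarith
      calc (t : ℝ) * f i = Real.sqrt t * (Real.sqrt t * f i) := by rw [← mul_assoc, h3]
        _ ≤ Real.sqrt μ * (4 * W) := by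
          apply mul_le_mul h2 h4 _ hsq.le
          positivity
        _ = _ := by ring
    have hfin := sum_le_harmonic f (4 * Real.sqrt μ * W) (by positivity) I.card I rfl key
      (fun i hi => (hIf i hi).le)
    rw [hsumI] at hfin
    have hIpos : 0 < I.card := by
      rw [Finset.card_pos]
      by_contra h
      rw [Finset.not_nonempty_iff_eq_empty] at h
      rw [h] at hsumI
      simp at hsumI
      linarith
    have hH : (harmonic I.card : ℝ) ≤ Real.logb 2 μ + 2 := by
      refine (harmonic_le_one_add_log _).trans ?_
      have h1 : Real.log I.card ≤ Real.log μ :=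
        Real.log_le_log (by exact_mod_cast hIpos) (by exact_mod_cast hIμ)
      have h2 : Real.log μ ≤ Real.logb 2 μ := by
        rw [Real.logb, le_div_iff₀ (Real.log_pos (by norm_num))]
        have h3 : Real.log 2 ≤ 1 := by
          have := Real.log_two_lt_d9
          linarith
        exact mul_le_of_le_one_right (Real.log_nonneg hμR) h3
      linarith
    have h5 : OPT Mk ≤ 4 * Real.sqrt μ * W * (Real.logb 2 μ + 2) :=
      hfin.trans (mul_le_mul_of_nonneg_left hH (by positivity))
    have h6 : 4 * Real.sqrt μ * W * (Real.logb 2 μ + 2) = OPT Mk / 2 := by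
      rw [hW]
      have : Real.logb 2 μ + 2 ≠ 0 := by positivity
      field_simp
      norm_num
    linarith
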